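/- arXiv:2101.04528 — 4 statements merged into one kernel-verified Lean document; each statement's English description precedes it below -/
import Mathlib

section
/- For every integer k with n−1 ≤ k ≤ 2n, the linear map W_k : ⋀^k E → ⋀^{k+2}E defined by W_k(α) = ω ∧ α is surjective. -/
open ExteriorAlgebra

/-- The wedge-multiplication map `W_k : ⋀^k E → ⋀^{k+2} E`, `α ↦ ω ∧ α`. -/
noncomputable def wedgeOmega {E : Type*} [AddCommGroup E] [Module ℝ E]
    (ω : ExteriorAlgebra ℝ E) (hω : ω ∈ ⋀[ℝ]^2 E) (k : ℕ) :
    (⋀[ℝ]^k E) →ₗ[ℝ] (⋀[ℝ]^(k+2) E) where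
  toFun α := ⟨ω * (α : ExteriorAlgebra ℝ E), by
    have : ω * (α : ExteriorAlgebra ℝ E) ∈ (⋀[ℝ]^2 E) * (⋀[ℝ]^k E) :=
      Submodule.mul_mem_mul hω α.2
    rwa [← pow_add, add_comm] at this⟩
  map_add' α β := Subtype.ext (by simp [mul_add])
  map_smul' c α := Subtype.ext (by simp [mul_smul_comm])

namespace LefschetzAux

open Module CliffordAlgebra

variable {E : Type*} [AddCommGroup E] [Module ℝ E]

/-- contraction on the exterior algebra -/
noncomputable def ctr (d : Dual ℝ E) : ExteriorAlgebra ℝ E →ₗ[ℝ] ExteriorAlgebra ℝ E :=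
  contractLeft (Q := (0 : QuadraticForm ℝ E)) d

lemma ctr_mul (d : Dual ℝ E) (v : E) (x : ExteriorAlgebra ℝ E) :
    ctr d (ExteriorAlgebra.ι ℝ v * x) = d v • x - ExteriorAlgebra.ι ℝ v * ctr d x :=
  contractLeft_ι_mul (Q := (0 : QuadraticForm ℝ E)) d v x

lemma ctr_ι (d : Dual ℝ E) (v : E) :
    ctr d (ExteriorAlgebra.ι ℝ v) = algebraMap ℝ _ (d v) :=
  contractLeft_ι (Q := (0 : QuadraticForm ℝ E)) d v

lemma ctr_one (d : Dual ℝ E) : ctr d (1 : ExteriorAlgebra ℝ E) = 0 :=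
  contractLeft_one (Q := (0 : QuadraticForm ℝ E)) d

lemma ctr_comm (d d' : Dual ℝ E) (x : ExteriorAlgebra ℝ E) :
    ctr d (ctr d' x) = - ctr d' (ctr d x) :=
  contractLeft_comm (Q := (0 : QuadraticForm ℝ E)) d d' x

lemma ctr_mem (d : Dual ℝ E) (m : ℕ) : ∀ x ∈ ⋀[ℝ]^(m+1) E, ctr d x ∈ ⋀[ℝ]^m E := by
  induction m with
  | zero =>
    intro x hx
    rw [zero_add, exteriorPower, pow_one] at hx
    obtain ⟨v, rfl⟩ := hx
    rw [ctr_ι, exteriorPower, pow_zero]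
    exact Submodule.algebraMap_mem _
  | succ m ih =>
    intro x hx
    rw [exteriorPower, pow_succ'] at hx
    induction hx using Submodule.mul_induction_on' with
    | mem_mul_mem a ha b hb =>
      obtain ⟨v, rfl⟩ := ha
      rw [ctr_mul]
      refine Submodule.sub_mem _ (Submodule.smul_mem _ _ hb) ?_
      rw [exteriorPower, pow_succ']
      exact Submodule.mul_mem_mul ⟨v, rfl⟩ (ih b hb)
    | add a _ b _ h1 h2 => rw [map_add]; exact Submodule.add_mem _ h1 h2

lemma ctr_omega_mul (d : Dual ℝ E) {ω : ExteriorAlgebra ℝ E} (hω : ω ∈ ⋀[ℝ]^2 E)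
    (x : ExteriorAlgebra ℝ E) : ctr d (ω * x) = ctr d ω * x + ω * ctr d x := by
  rw [exteriorPower, pow_two] at hω
  induction hω using Submodule.mul_induction_on' with
  | mem_mul_mem a ha b hb =>
    obtain ⟨v, rfl⟩ := ha
    obtain ⟨w, rfl⟩ := hb
    rw [mul_assoc, ctr_mul, ctr_mul, ctr_mul, ctr_ι, Algebra.algebraMap_eq_smul_one]
    simp only [mul_sub, sub_mul, smul_mul_assoc, mul_smul_comm, mul_one, mul_assoc]
    abel
  | add a _ b _ h1 h2 => rw [add_mul, map_add, map_add, h1, h2, add_mul, add_mul]; abel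

lemma ctr_omega_pow (d : Dual ℝ E) {ω : ExteriorAlgebra ℝ E} (hω : ω ∈ ⋀[ℝ]^2 E)
    (h : ctr d ω = 0) (n : ℕ) : ctr d (ω ^ n) = 0 := by
  induction n with
  | zero => rw [pow_zero, ctr_one]
  | succ n ih => rw [pow_succ', ctr_omega_mul d hω, h, ih]; simp

lemma euler {I : Type*} [Fintype I] (e : I → E) (d : I → Dual ℝ E) (c : ℝ)
    (h : ∀ v, ∑ i, d i v • e i = c • v) (m : ℕ) :
    ∀ x ∈ ⋀[ℝ]^m E, ∑ i, ExteriorAlgebra.ι ℝ (e i) * ctr (d i) x = (c * m) • x := by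
  induction m with
  | zero =>
    intro x hx
    rw [exteriorPower, pow_zero] at hx
    obtain ⟨r, rfl⟩ := Submodule.mem_one.1 hx
    simp [Algebra.algebraMap_eq_smul_one, ctr_one]
  | succ m ih =>
    intro x hx
    rw [exteriorPower, pow_succ'] at hx
    induction hx using Submodule.mul_induction_on' with
    | mem_mul_mem a ha b hb =>
      obtain ⟨v, rfl⟩ := ha
      have key : ∀ i, ExteriorAlgebra.ι ℝ (e i) * ctr (d i) (ExteriorAlgebra.ι ℝ v * b)
          = ExteriorAlgebra.ι ℝ (d i v • e i) * b
            + ExteriorAlgebra.ι ℝ v * (ExteriorAlgebra.ι ℝ (e i) * ctr (d i) b) := by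
        intro i
        have h2 := ExteriorAlgebra.ι_add_mul_swap (R := ℝ) (e i) v
        rw [ctr_mul, mul_sub, ← mul_assoc, ← mul_assoc, eq_neg_of_add_eq_zero_left h2, map_smul]
        simp
      simp only [key]
      rw [Finset.sum_add_distrib, ← Finset.sum_mul, ← Finset.mul_sum, ← map_sum, h, ih b hb,
        map_smul, mul_smul_comm, smul_mul_assoc, ← add_smul]
      congr 1
      push_cast; ring
    | add a _ b _ h1 h2 =>
      simp only [map_add, mul_add, Finset.sum_add_distrib, h1, h2, smul_add]

lemma top_zero [FiniteDimensional ℝ E] {m : ℕ} (hm : finrank ℝ E < m)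
    {x : ExteriorAlgebra ℝ E} (hx : x ∈ ⋀[ℝ]^m E) : x = 0 := by
  have h : finrank ℝ (⋀[ℝ]^m E) = 0 := by
    rw [exteriorPower.finrank_eq, Nat.choose_eq_zero_of_lt hm]
  have h2 := Submodule.finrank_eq_zero.1 h
  rw [h2] at hx
  simpa using hx

lemma omega_pow_mul_mem {ω : ExteriorAlgebra ℝ E} (hω : ω ∈ ⋀[ℝ]^2 E) {m : ℕ}
    {x : ExteriorAlgebra ℝ E} (hx : x ∈ ⋀[ℝ]^m E) (j : ℕ) :
    ω ^ j * x ∈ ⋀[ℝ]^(m + 2 * j) E := by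
  have h : ω ^ j * x ∈ (⋀[ℝ]^2 E) ^ j * ⋀[ℝ]^m E :=
    Submodule.mul_mem_mul (Submodule.pow_mem_pow _ hω j) hx
  rwa [← pow_mul, ← pow_add, add_comm] at h

lemma exists_lambda [FiniteDimensional ℝ E] (n : ℕ)
    (hdim : finrank ℝ E = 2 * n)
    (ω : ExteriorAlgebra ℝ E) (hω : ω ∈ ⋀[ℝ]^2 E) (hωn : ω ^ n ≠ 0) :
    ∃ Λ : ExteriorAlgebra ℝ E →ₗ[ℝ] ExteriorAlgebra ℝ E,
      (∀ m, ∀ x ∈ ⋀[ℝ]^(m+2) E, Λ x ∈ ⋀[ℝ]^m E) ∧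
      (∀ m : ℕ, ∀ x ∈ ⋀[ℝ]^m E, Λ (ω * x) = ω * Λ x + (2 * ((n:ℝ) - m)) • x) := by
  let S : Dual ℝ E →ₗ[ℝ] E := ExteriorAlgebra.ιInv ∘ₗ
    (contractLeft (Q := (0 : QuadraticForm ℝ E))).flip ω
  have hS : ∀ d, ExteriorAlgebra.ι ℝ (S d) = ctr d ω := by
    intro d
    have := ctr_mem d 1 ω hω
    rw [exteriorPower, pow_one] at this
    obtain ⟨v, hv⟩ := this
    have : S d = ExteriorAlgebra.ιInv (ctr d ω) := rfl
    rw [this, ← hv, ExteriorAlgebra.ι_leftInverse]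
  have hinj : Function.Injective S := by
    rw [injective_iff_map_eq_zero]
    intro d hd
    have h0 : ctr d ω = 0 := by rw [← hS, hd, map_zero]
    have h1 := ctr_omega_pow d hω h0 n
    ext v
    have h2 : ExteriorAlgebra.ι ℝ v * ω ^ n = 0 := by
      refine top_zero (m := 2 * n + 1) (by omega) ?_
      rw [exteriorPower, pow_succ', pow_mul]
      exact Submodule.mul_mem_mul ⟨v, rfl⟩ (Submodule.pow_mem_pow _ hω n)
    have h3 := ctr_mul d v (ω ^ n)
    rw [h2, h1, map_zero, mul_zero, sub_zero] at h3
    simpa [hωn] using h3.symm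
  have hsurj : Function.Surjective S :=
    (LinearMap.injective_iff_surjective_of_finrank_eq_finrank
      (Subspace.dual_finrank_eq)).1 hinj
  let b := Module.finBasis ℝ E
  choose d hd using fun i => hsurj (b i)
  have H1 : ∀ v, ∑ i, b.coord i v • b i = (1:ℝ) • v := by
    intro v; simpa using b.sum_repr v
  have H2 : ∀ v, ∑ i, d i v • S (b.coord i) = (-1:ℝ) • v := by
    intro v
    obtain ⟨e, rfl⟩ := hsurj v
    have h1 : ∀ i, d i (S e) = - e (b i) := by
      intro i
      have h := ctr_comm (d i) e ω
      rw [← hS, ← hS, ctr_ι, ctr_ι, hd, ← map_neg] at h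
      exact (ExteriorAlgebra.algebraMap_inj E _ _).1 h
    have h2 : e = ∑ i, e (b i) • b.coord i := by
      refine b.ext fun j => ?_
      simp [Finsupp.single_apply]
    simp only [h1, neg_smul, Finset.sum_neg_distrib, one_smul]
    have h3 := congrArg S h2
    simp only [map_sum, map_smul] at h3
    rw [← h3]
  refine ⟨∑ i, ctr (b.coord i) ∘ₗ ctr (d i), ?_, ?_⟩
  · intro m x hx
    rw [LinearMap.sum_apply]
    exact Submodule.sum_mem _ fun i _ => ctr_mem _ _ _ (ctr_mem _ _ _ hx)
  · intro m x hx
    have E1 := euler _ _ _ H1 m x hx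
    have E2 := euler _ _ _ H2 m x hx
    have key : ∀ i, ctr (b.coord i) (ctr (d i) (ω * x)) =
        ω * ctr (b.coord i) (ctr (d i) x) + x
        - ExteriorAlgebra.ι ℝ (b i) * ctr (b.coord i) x
        + ExteriorAlgebra.ι ℝ (S (b.coord i)) * ctr (d i) x := by
      intro i
      rw [ctr_omega_mul _ hω, ← hS, hd, map_add, ctr_mul, ctr_omega_mul _ hω, ← hS]
      simp
      abel
    simp only [LinearMap.sum_apply, LinearMap.comp_apply, key, Finset.sum_add_distrib,
      Finset.sum_sub_distrib, E1, E2, Finset.mul_sum]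
    simp only [Finset.sum_const, Finset.card_univ, Fintype.card_fin, hdim]
    rw [← Nat.cast_smul_eq_nsmul ℝ]
    push_cast
    module

lemma lambda_pow {n : ℕ} {ω : ExteriorAlgebra ℝ E} (hω : ω ∈ ⋀[ℝ]^2 E)
    (Λ : ExteriorAlgebra ℝ E →ₗ[ℝ] ExteriorAlgebra ℝ E)
    (h : ∀ m : ℕ, ∀ x ∈ ⋀[ℝ]^m E, Λ (ω * x) = ω * Λ x + (2 * ((n:ℝ) - m)) • x)
    {m : ℕ} {x : ExteriorAlgebra ℝ E} (hx : x ∈ ⋀[ℝ]^m E) (j : ℕ) :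
    Λ (ω ^ (j+1) * x) = ω ^ (j+1) * Λ x + (2 * (j+1) * ((n:ℝ) - m - j)) • (ω ^ j * x) := by
  induction j with
  | zero => simpa using h m x hx
  | succ j ih =>
    rw [pow_succ', mul_assoc, h _ _ (omega_pow_mul_mem hω hx (j+1)), ih, mul_add, mul_smul_comm,
      ← mul_assoc, ← mul_assoc, ← pow_succ', ← pow_succ']
    push_cast
    module

lemma main_aux {n : ℕ} {ω : ExteriorAlgebra ℝ E} (hω : ω ∈ ⋀[ℝ]^2 E)
    (Λ : ExteriorAlgebra ℝ E →ₗ[ℝ] ExteriorAlgebra ℝ E)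
    (hΛ : ∀ m, ∀ x ∈ ⋀[ℝ]^(m+2) E, Λ x ∈ ⋀[ℝ]^m E)
    (h : ∀ m : ℕ, ∀ x ∈ ⋀[ℝ]^m E, Λ (ω * x) = ω * Λ x + (2 * ((n:ℝ) - m)) • x)
    {k : ℕ} (hk : n < k + 2) (j : ℕ) :
    ∀ x ∈ ⋀[ℝ]^(k+2) E, ω ^ j * x = 0 → ∃ y ∈ ⋀[ℝ]^k E, ω * y = x := by
  induction j with
  | zero => intro x _ h0; exact ⟨0, Submodule.zero_mem _, by simpa using h0.symm⟩
  | succ j ih =>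
    intro x hx h0
    have h1 := lambda_pow hω Λ h hx j
    rw [h0, map_zero] at h1
    set c : ℝ := 2 * (j+1) * ((n:ℝ) - (k+2 : ℕ) - j) with hc
    have hc0 : c ≠ 0 := by
      have : (n:ℝ) < (k+2 : ℕ) := by exact_mod_cast hk
      have hj : (0:ℝ) ≤ j := Nat.cast_nonneg j
      exact mul_ne_zero (by positivity) (by linarith)
    have hm := hΛ k x hx
    obtain ⟨y, hy, hyx⟩ := ih (x + c⁻¹ • (ω * Λ x)) (by
        refine Submodule.add_mem _ hx (Submodule.smul_mem _ _ ?_)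
        simpa using omega_pow_mul_mem hω hm 1) (by
        rw [mul_add, mul_smul_comm, ← mul_assoc, ← pow_succ,
          eq_neg_of_add_eq_zero_left h1.symm, smul_neg, smul_smul, inv_mul_cancel₀ hc0]
        simp)
    refine ⟨y - c⁻¹ • Λ x, Submodule.sub_mem _ hy (Submodule.smul_mem _ _ hm), ?_⟩
    rw [mul_sub, hyx, mul_smul_comm]; abel

end LefschetzAux

/-- for `n-1 ≤ k ≤ 2n`, the map `W_k` is surjective. -/
theorem wedgeOmega_surjective {E : Type*} [AddCommGroup E] [Module ℝ E]
    [FiniteDimensional ℝ E] (n : ℕ) (hn : 1 ≤ n)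
    (hdim : Module.finrank ℝ E = 2 * n)
    (ω : ExteriorAlgebra ℝ E) (hω : ω ∈ ⋀[ℝ]^2 E) (hωn : ω ^ n ≠ 0)
    (k : ℕ) (hk₁ : n - 1 ≤ k) (hk₂ : k ≤ 2 * n) :
    Function.Surjective (wedgeOmega ω hω k) := by
  obtain ⟨Λ, h1, h2⟩ := LefschetzAux.exists_lambda n hdim ω hω hωn
  rintro ⟨x, hx⟩
  obtain ⟨y, hy, hyx⟩ := LefschetzAux.main_aux hω Λ h1 h2 (k := k) (by omega) (n + 1) x hx
    (LefschetzAux.top_zero (m := k + 2 + 2 * (n + 1)) (by omega)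
      (LefschetzAux.omega_pow_mul_mem hω hx (n + 1)))
  exact ⟨⟨y, hy⟩, Subtype.ext hyx⟩
end

section
/- For every integer k with 0 ≤ k ≤ n, the kernel of the linear map W_{2n−k} : ⋀^{2n−k}E → ⋀^{2n−k+2}E, η ↦ ω ∧ η, has dimension binom(2n, k) − binom(2n, k−2), where binom(2n, j) denotes the binomial coefficient and is interpreted as 0 for j < 0. -/
open ExteriorAlgebra

/-- The kernel of `W_j : ⋀^j E → ⋀^{j+2} E`, `η ↦ ω ∧ η`, i.e.
`{η ∈ ⋀^j E : ω ∧ η = 0}`, as a submodule of the exterior algebra. -/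
noncomputable def kerW {E : Type*} [AddCommGroup E] [Module ℝ E]
    (ω : ExteriorAlgebra ℝ E) (j : ℕ) : Submodule ℝ (ExteriorAlgebra ℝ E) :=
  (⋀[ℝ]^j E) ⊓ LinearMap.ker (LinearMap.mulLeft ℝ ω)

namespace KerWAux

variable {E : Type*} [AddCommGroup E] [Module ℝ E]

/-- Contraction by `d` on the exterior algebra. -/
noncomputable def con (d : Module.Dual ℝ E) : ExteriorAlgebra ℝ E →ₗ[ℝ] ExteriorAlgebra ℝ E :=
  CliffordAlgebra.contractLeft (Q := (0 : QuadraticForm ℝ E)) d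

theorem con_ι_mul (d : Module.Dual ℝ E) (a : E) (x : ExteriorAlgebra ℝ E) :
    con d (ι ℝ a * x) = d a • x - ι ℝ a * con d x :=
  CliffordAlgebra.contractLeft_ι_mul d a x

theorem con_algebraMap (d : Module.Dual ℝ E) (r : ℝ) :
    con d (algebraMap ℝ (ExteriorAlgebra ℝ E) r) = 0 :=
  CliffordAlgebra.contractLeft_algebraMap _ d r

theorem con_ι (d : Module.Dual ℝ E) (a : E) :
    con d (ι ℝ a) = algebraMap ℝ (ExteriorAlgebra ℝ E) (d a) :=
  CliffordAlgebra.contractLeft_ι _ d a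

/-- Induction principle for products. -/
theorem succ_induction {k : ℕ} {C : ExteriorAlgebra ℝ E → Prop}
    (h : ∀ (v : E) (x), x ∈ ⋀[ℝ]^k E → C (ι ℝ v * x))
    (hadd : ∀ x y, C x → C y → C (x + y))
    {x : ExteriorAlgebra ℝ E} (hx : x ∈ ⋀[ℝ]^(k + 1) E) : C x := by
  rw [exteriorPower, pow_succ'] at hx
  refine Submodule.mul_induction_on hx ?_ hadd
  rintro _ ⟨v, rfl⟩ y hy
  exact h v y hy

theorem mem_zero {x : ExteriorAlgebra ℝ E} (hx : x ∈ ⋀[ℝ]^0 E) :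
    ∃ r : ℝ, x = algebraMap ℝ (ExteriorAlgebra ℝ E) r := by
  rw [exteriorPower, pow_zero] at hx
  obtain ⟨r, hr⟩ := Submodule.mem_one.1 hx
  exact ⟨r, hr.symm⟩

theorem two_induction {C : ExteriorAlgebra ℝ E → Prop}
    (h : ∀ (a b : E), C (ι ℝ a * ι ℝ b))
    (hadd : ∀ x y, C x → C y → C (x + y))
    {x : ExteriorAlgebra ℝ E} (hx : x ∈ ⋀[ℝ]^2 E) : C x := by
  rw [exteriorPower, pow_two] at hx
  refine Submodule.mul_induction_on hx ?_ hadd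
  rintro _ ⟨v, rfl⟩ _ ⟨w, rfl⟩
  exact h v w

theorem swap (a b : E) : ι ℝ a * ι ℝ b = - (ι ℝ b * ι ℝ a) :=
  eq_neg_of_add_eq_zero_left (ExteriorAlgebra.ι_add_mul_swap a b)

theorem central {ω : ExteriorAlgebra ℝ E} (hω : ω ∈ ⋀[ℝ]^2 E) (x : ExteriorAlgebra ℝ E) :
    Commute ω x := by
  refine two_induction (C := fun ω => Commute ω x) ?_ (fun _ _ h h' => h.add_left h') hω
  intro a b
  induction x using ExteriorAlgebra.induction with
  | algebraMap r => exact (Algebra.commutes r _).symm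
  | ι c =>
    change ι ℝ a * ι ℝ b * ι ℝ c = ι ℝ c * (ι ℝ a * ι ℝ b)
    rw [mul_assoc, swap b c, mul_neg, ← mul_assoc, swap a c, neg_mul, neg_neg, mul_assoc]
  | mul x y hx hy => exact hx.mul_right hy
  | add x y hx hy => exact hx.add_right hy

theorem con_two_mul {ω : ExteriorAlgebra ℝ E} (hω : ω ∈ ⋀[ℝ]^2 E) (d : Module.Dual ℝ E)
    (x : ExteriorAlgebra ℝ E) : con d (ω * x) = con d ω * x + ω * con d x := by
  refine two_induction (C := fun ω => con d (ω * x) = con d ω * x + ω * con d x) ?_ ?_ hω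
  · intro a b
    simp only [mul_assoc, con_ι_mul, con_ι, mul_sub, sub_mul, Algebra.algebraMap_eq_smul_one,
      mul_smul_comm, smul_mul_assoc, mul_one]
    abel
  · intro y z hy hz
    simp only [add_mul, map_add, hy, hz]
    abel

theorem con_pow_mul {ω : ExteriorAlgebra ℝ E} (hω : ω ∈ ⋀[ℝ]^2 E) (d : Module.Dual ℝ E)
    (m : ℕ) (x : ExteriorAlgebra ℝ E) :
    ω * con d (ω ^ m * x) = m • (con d ω * (ω ^ m * x)) + ω ^ (m + 1) * con d x := by
  induction m with
  | zero => simp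
  | succ m ih =>
    have hc : ω * con d ω = con d ω * ω := central hω _
    have e : ω ^ (m + 1) * x = ω * (ω ^ m * x) := by rw [pow_succ', mul_assoc]
    rw [e, con_two_mul hω, ih, mul_add, mul_add, mul_smul_comm, ← mul_assoc ω (con d ω), hc,
      mul_assoc (con d ω) ω, succ_nsmul', add_assoc, ← mul_assoc ω (ω ^ (m + 1)), ← pow_succ']

theorem con_mem (d : Module.Dual ℝ E) {k : ℕ} {x : ExteriorAlgebra ℝ E}
    (hx : x ∈ ⋀[ℝ]^(k + 1) E) : con d x ∈ ⋀[ℝ]^k E := by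
  induction k generalizing x with
  | zero =>
    refine succ_induction (C := fun x => con d x ∈ ⋀[ℝ]^0 E) ?_ ?_ hx
    · intro v y hy
      obtain ⟨r, rfl⟩ := mem_zero hy
      rw [con_ι_mul, con_algebraMap, mul_zero, sub_zero]
      exact Submodule.smul_mem _ _ hy
    · intro x y hx hy
      rw [map_add]; exact Submodule.add_mem _ hx hy
  | succ k ih =>
    refine succ_induction (C := fun x => con d x ∈ ⋀[ℝ]^(k + 1) E) ?_ ?_ hx
    · intro v y hy
      rw [con_ι_mul]
      refine Submodule.sub_mem _ (Submodule.smul_mem _ _ hy) ?_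
      have h2 := ih hy
      rw [exteriorPower, pow_succ']
      exact Submodule.mul_mem_mul ⟨v, rfl⟩ h2
    · intro x y hx hy
      rw [map_add]; exact Submodule.add_mem _ hx hy

theorem euler {I : Type*} [Fintype I] (b : Module.Basis I ℝ E) (k : ℕ) {x : ExteriorAlgebra ℝ E}
    (hx : x ∈ ⋀[ℝ]^k E) : ∑ i, ι ℝ (b i) * con (b.coord i) x = k • x := by
  induction k generalizing x with
  | zero =>
    obtain ⟨r, rfl⟩ := mem_zero hx
    simp [con_algebraMap]
  | succ k ih =>
    refine succ_induction (C := fun x => ∑ i, ι ℝ (b i) * con (b.coord i) x = (k + 1) • x) ?_ ?_ hx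
    · intro v y hy
      have h1 : ∑ i, b.coord i v • (ι ℝ (b i) * y) = ι ℝ v * y := by
        conv_rhs => rw [← b.sum_repr v]
        rw [map_sum, Finset.sum_mul]
        refine Finset.sum_congr rfl fun i _ => ?_
        rw [map_smul, smul_mul_assoc, Module.Basis.coord_apply]
      have h2 : ∑ i, ι ℝ (b i) * (ι ℝ v * con (b.coord i) y) = - (ι ℝ v * (k • y)) := by
        rw [← ih hy, Finset.mul_sum, ← Finset.sum_neg_distrib]
        refine Finset.sum_congr rfl fun i _ => ?_
        rw [← mul_assoc, swap, neg_mul, mul_assoc]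
      simp only [con_ι_mul, mul_sub, mul_smul_comm, Finset.sum_sub_distrib]
      rw [h1, h2, mul_smul_comm, succ_nsmul]
      abel
    · intro x y hx hy
      simp only [map_add, mul_add, Finset.sum_add_distrib, hx, hy, smul_add]

theorem eq_zero_of_con [FiniteDimensional ℝ E] {k : ℕ} {x : ExteriorAlgebra ℝ E}
    (hx : x ∈ ⋀[ℝ]^(k + 1) E) (h : ∀ d, con d x = 0) : x = 0 := by
  have := euler (Module.finBasis ℝ E) (k + 1) hx
  simp only [h, mul_zero, Finset.sum_const_zero] at this
  rw [← Nat.cast_smul_eq_nsmul ℝ] at this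
  exact (smul_eq_zero.1 this.symm).resolve_left (by positivity)

/-- Injectivity half of the hard Lefschetz theorem. -/
theorem lefschetz [FiniteDimensional ℝ E] {n : ℕ} {ω : ExteriorAlgebra ℝ E}
    (hω : ω ∈ ⋀[ℝ]^2 E) (hωn : ω ^ n ≠ 0) (k m : ℕ) (hkm : k + m = n)
    {x : ExteriorAlgebra ℝ E} (hx : x ∈ ⋀[ℝ]^k E) (h0 : ω ^ m * x = 0) : x = 0 := by
  induction k generalizing m x with
  | zero =>
    obtain ⟨r, rfl⟩ := mem_zero hx
    obtain rfl : m = n := by omega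
    rw [Algebra.algebraMap_eq_smul_one, mul_smul_comm, mul_one] at h0
    rw [(smul_eq_zero.1 h0).resolve_right hωn, map_zero]
  | succ k ih =>
    refine eq_zero_of_con hx fun d => ?_
    refine ih (m + 1) (by omega) (con_mem d hx) ?_
    have := con_pow_mul hω d m x
    rw [h0] at this
    simpa using this.symm

theorem pow_mul_mem {ω : ExteriorAlgebra ℝ E} (hω : ω ∈ ⋀[ℝ]^2 E) (m : ℕ) {j : ℕ}
    {x : ExteriorAlgebra ℝ E} (hx : x ∈ ⋀[ℝ]^j E) : ω ^ m * x ∈ ⋀[ℝ]^(2 * m + j) E := by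
  rw [exteriorPower, pow_add, pow_mul]
  exact Submodule.mul_mem_mul (Submodule.pow_mem_pow _ hω m) hx

/-- Multiplication by a power of `ω`, as a map between exterior powers. -/
noncomputable def W {ω : ExteriorAlgebra ℝ E} (hω : ω ∈ ⋀[ℝ]^2 E) (m j l : ℕ)
    (h : 2 * m + j = l) : ⋀[ℝ]^j E →ₗ[ℝ] ⋀[ℝ]^l E :=
  (LinearMap.mulLeft ℝ (ω ^ m)).restrict fun _ hx => h ▸ pow_mul_mem hω m hx

theorem W_coe {ω : ExteriorAlgebra ℝ E} (hω : ω ∈ ⋀[ℝ]^2 E) (m j l : ℕ)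
    (h : 2 * m + j = l) (x : ⋀[ℝ]^j E) :
    (W hω m j l h x : ExteriorAlgebra ℝ E) = ω ^ m * x := rfl

theorem finrank_kerW_eq {ω : ExteriorAlgebra ℝ E} (hω : ω ∈ ⋀[ℝ]^2 E) (j l : ℕ)
    (h : 2 * 1 + j = l) :
    Module.finrank ℝ (kerW ω j) = Module.finrank ℝ (LinearMap.ker (W hω 1 j l h)) := by
  have : kerW ω j = (LinearMap.ker (W hω 1 j l h)).map (⋀[ℝ]^j E).subtype := by
    ext x
    simp only [kerW, Submodule.mem_inf, LinearMap.mem_ker, LinearMap.mulLeft_apply,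
      Submodule.mem_map, Submodule.subtype_apply]
    constructor
    · rintro ⟨h1, h2⟩
      refine ⟨⟨x, h1⟩, ?_, rfl⟩
      apply Subtype.ext
      rw [W_coe, pow_one]; exact h2
    · rintro ⟨y, hy, rfl⟩
      refine ⟨y.2, ?_⟩
      have := congrArg Subtype.val hy
      rw [W_coe, pow_one] at this; exact this
  rw [this]
  exact Submodule.finrank_map_subtype_eq _ _

theorem W_surjective [FiniteDimensional ℝ E] {n : ℕ} (hdim : Module.finrank ℝ E = 2 * n)
    {ω : ExteriorAlgebra ℝ E}
    (hω : ω ∈ ⋀[ℝ]^2 E) (hωn : ω ^ n ≠ 0) (k : ℕ) (hk : k ≤ n) 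
    (h : 2 * 1 + (2 * n - k) = 2 * n - k + 2) :
    Function.Surjective (W hω 1 (2 * n - k) (2 * n - k + 2) h) := by
  by_cases hk2 : 2 ≤ k
  · obtain ⟨k, rfl⟩ := Nat.exists_eq_add_of_le' hk2
    have hl : 2 * (n - k) + k = 2 * n - (k + 2) + 2 := by omega
    have hinj : Function.Injective (W hω (n - k) k _ hl) := by
      rw [injective_iff_map_eq_zero]
      intro x hx
      have := congrArg Subtype.val hx
      rw [W_coe] at this
      exact Subtype.ext (lefschetz hω hωn k (n - k) (by omega) x.2 this)
    have hfr : Module.finrank ℝ (⋀[ℝ]^k E) = Module.finrank ℝ (⋀[ℝ]^(2 * n - (k + 2) + 2) E) := by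
      rw [exteriorPower.finrank_eq, exteriorPower.finrank_eq, hdim]
      rw [show 2 * n - (k + 2) + 2 = 2 * n - k by omega, Nat.choose_symm (by omega)]
    have hsurj := (LinearMap.injective_iff_surjective_of_finrank_eq_finrank hfr).1 hinj
    intro y
    obtain ⟨x, rfl⟩ := hsurj y
    refine ⟨W hω (n - k - 1) k _ (by omega) x, ?_⟩
    apply Subtype.ext
    rw [W_coe, W_coe, W_coe, ← mul_assoc, ← pow_add]
    congr 2
    omega
  · have : Module.finrank ℝ (⋀[ℝ]^(2 * n - k + 2) E) = 0 := by
      rw [exteriorPower.finrank_eq, hdim, Nat.choose_eq_zero_of_lt (by omega)]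
    have := Module.finrank_zero_iff.1 this
    intro y
    exact ⟨0, Subsingleton.elim _ _⟩

end KerWAux

/-- for `0 ≤ k ≤ n`, the kernel of `W_{2n-k} : ⋀^{2n-k} E → ⋀^{2n-k+2} E`
has dimension `binom(2n, k) - binom(2n, k-2)`, the latter binomial coefficient being
interpreted as `0` when `k - 2 < 0`. -/
theorem finrank_kerW {E : Type*} [AddCommGroup E] [Module ℝ E]
    [FiniteDimensional ℝ E] (n : ℕ) (hn : 1 ≤ n)
    (hdim : Module.finrank ℝ E = 2 * n)
    (ω : ExteriorAlgebra ℝ E) (hω : ω ∈ ⋀[ℝ]^2 E) (hωn : ω ^ n ≠ 0)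
    (k : ℕ) (hk : k ≤ n) :
    Module.finrank ℝ (kerW ω (2 * n - k)) =
      Nat.choose (2 * n) k - (if 2 ≤ k then Nat.choose (2 * n) (k - 2) else 0) := by
  have h2 : 2 * 1 + (2 * n - k) = 2 * n - k + 2 := by omega
  rw [KerWAux.finrank_kerW_eq hω _ _ h2]
  have hr := LinearMap.finrank_range_add_finrank_ker (KerWAux.W hω 1 (2 * n - k) _ h2)
  rw [LinearMap.range_eq_top.2 (KerWAux.W_surjective hdim hω hωn k hk h2), finrank_top,
    exteriorPower.finrank_eq, exteriorPower.finrank_eq, hdim, Nat.choose_symm (by omega)] at hr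
  split_ifs with hk2
  · have e : (2 * n).choose (2 * n - k + 2) = (2 * n).choose (k - 2) := by
      rw [show 2 * n - k + 2 = 2 * n - (k - 2) by omega, Nat.choose_symm (by omega)]
    omega
  · rw [Nat.choose_eq_zero_of_lt (by omega : 2 * n < 2 * n - k + 2)] at hr
    omega
end

section
/- For every integer k with 0 ≤ k ≤ n and every α ∈ ⋀^k F, one has α ∧ γ = 0 for all γ ∈ J^{2n+1−k} if and only if α ∈ I^k. In other words, the left kernel of the wedge-product pairing ⋀^k F × J^{2n+1−k} → ⋀^{2n+1}F is exactly I^k, so the induced pairing (⋀^k F / I^k) × J^{2n+1−k} → ⋀^{2n+1}F has trivial left kernel. -/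
open ExteriorAlgebra

/-- The `j`-th exterior power of the subspace `E ⊆ F`, viewed inside the exterior
algebra of `F` (by convention `{0}` for `j < 0`, and `ℝ·1` for `j = 0`). -/
noncomputable def powE {F : Type*} [AddCommGroup F] [Module ℝ F]
    (E : Submodule ℝ F) (j : ℤ) : Submodule ℝ (ExteriorAlgebra ℝ F) :=
  if 0 ≤ j then (Submodule.map (ExteriorAlgebra.ι ℝ) E) ^ j.toNat else ⊥

/-- Membership in `I^k = {θ ∧ α + ω ∧ β : α ∈ ⋀^{k-1} E, β ∈ ⋀^{k-2} E}`. -/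
def memI {F : Type*} [AddCommGroup F] [Module ℝ F] (E : Submodule ℝ F)
    (θ : F) (ω : ExteriorAlgebra ℝ F) (k : ℤ) (γ : ExteriorAlgebra ℝ F) : Prop :=
  ∃ a ∈ powE E (k - 1), ∃ b ∈ powE E (k - 2), γ = ExteriorAlgebra.ι ℝ θ * a + ω * b

section LK

variable {F : Type*} [AddCommGroup F] [Module ℝ F]

theorem lk_ind (j : ℕ) (P : ℕ → ExteriorAlgebra ℝ F → Prop)
    (h0 : ∀ r : ℝ, P 0 (algebraMap ℝ _ r))
    (hadd : ∀ i x y, P i x → P i y → P i (x + y))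
    (hmul : ∀ i (v : F) x, x ∈ ⋀[ℝ]^i F → P i x → P (i + 1) (ι ℝ v * x))
    (x : ExteriorAlgebra ℝ F) (hx : x ∈ ⋀[ℝ]^j F) : P j x := by
  induction hx using Submodule.pow_induction_on_left' with
  | algebraMap r => exact h0 r
  | add x y i hx hy h1 h2 => exact hadd _ _ _ h1 h2
  | mem_mul m hm i x hx h =>
    obtain ⟨v, rfl⟩ := hm
    exact hmul _ _ _ hx h

theorem lk_comm {j : ℕ} (v : F) {x : ExteriorAlgebra ℝ F} (hx : x ∈ ⋀[ℝ]^j F) :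
    ι ℝ v * x = (-1 : ℝ) ^ j • (x * ι ℝ v) := by
  refine lk_ind j (fun j x => ι ℝ v * x = (-1 : ℝ) ^ j • (x * ι ℝ v)) ?_ ?_ ?_ x hx
  · intro r
    simp [Algebra.commutes]
  · intro i x y h1 h2
    simp only [mul_add, add_mul, smul_add, h1, h2]
  · intro i w x _ h
    have h1 : ι ℝ v * ι ℝ w = - (ι ℝ w * ι ℝ v) :=
      eq_neg_of_add_eq_zero_left (ι_add_mul_swap v w)
    rw [← mul_assoc, h1, neg_mul, mul_assoc, h, pow_succ, mul_assoc]
    simp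

theorem lk_euler [FiniteDimensional ℝ F] {κ : Type*} [Fintype κ] (b : Module.Basis κ ℝ F)
    {j : ℕ} {x : ExteriorAlgebra ℝ F} (hx : x ∈ ⋀[ℝ]^j F) :
    ∑ i, ι ℝ (b i) * (CliffordAlgebra.contractLeft (Q := (0 : QuadraticForm ℝ F)) (b.coord i) x)
      = (j : ℝ) • x := by
  refine lk_ind j (fun j x => ∑ i, ι ℝ (b i) *
    (CliffordAlgebra.contractLeft (Q := (0 : QuadraticForm ℝ F)) (b.coord i) x)
      = (j : ℝ) • x) ?_ ?_ ?_ x hx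
  · intro r
    simp [CliffordAlgebra.contractLeft_algebraMap]
  · intro i x y h1 h2
    simp only [map_add, mul_add, Finset.sum_add_distrib, h1, h2, smul_add]
  · intro j v x _ h
    have h1 : ∀ i, ι ℝ (b i) * (CliffordAlgebra.contractLeft (Q := (0 : QuadraticForm ℝ F))
        (b.coord i) (ι ℝ v * x)) = ι ℝ (b.coord i v • b i) * x + ι ℝ v * (ι ℝ (b i) *
          (CliffordAlgebra.contractLeft (Q := (0 : QuadraticForm ℝ F)) (b.coord i) x)) := by
      intro i
      have h2 : ι ℝ (b i) * ι ℝ v = - (ι ℝ v * ι ℝ (b i)) :=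
        eq_neg_of_add_eq_zero_left (ι_add_mul_swap _ _)
      have h3 := CliffordAlgebra.contractLeft_ι_mul (Q := (0 : QuadraticForm ℝ F))
        (b.coord i) v x
      rw [show ι ℝ v = CliffordAlgebra.ι (0 : QuadraticForm ℝ F) v from rfl] at *
      rw [h3, mul_sub, ← mul_assoc, h2]
      simp [mul_assoc]
    simp only [h1, Finset.sum_add_distrib, ← Finset.mul_sum, h, ← Finset.sum_mul, ← map_sum]
    rw [show ∑ i, b.coord i v • b i = v from b.sum_repr v]
    push_cast
    rw [add_smul, one_smul, mul_smul_comm, add_comm]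

theorem lk_zero [FiniteDimensional ℝ F] {m : ℕ} (hm : m < Module.finrank ℝ F)
    {x : ExteriorAlgebra ℝ F} (hx : x ∈ ⋀[ℝ]^m F) (h : ∀ v, ι ℝ v * x = 0) : x = 0 := by
  have e := lk_euler (Module.finBasis ℝ F) hx
  have h1 : ∀ i, ι ℝ (Module.finBasis ℝ F i) *
      (CliffordAlgebra.contractLeft (Q := (0 : QuadraticForm ℝ F))
        ((Module.finBasis ℝ F).coord i) x) = x := by
    intro i
    have h3 := CliffordAlgebra.contractLeft_ι_mul (Q := (0 : QuadraticForm ℝ F))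
        ((Module.finBasis ℝ F).coord i) (Module.finBasis ℝ F i) x
    have h4 := h (Module.finBasis ℝ F i)
    rw [show ι ℝ (Module.finBasis ℝ F i) =
      CliffordAlgebra.ι (0 : QuadraticForm ℝ F) (Module.finBasis ℝ F i) from rfl] at *
    rw [h4] at h3
    simp only [map_zero, Module.Basis.coord_apply, Module.Basis.repr_self,
      Finsupp.single_eq_same, one_smul] at h3
    exact (sub_eq_zero.mp h3.symm).symm
  simp only [h1, Finset.sum_const, Finset.card_univ, Fintype.card_fin] at e
  rw [← Nat.cast_smul_eq_nsmul ℝ, ← sub_eq_zero, ← sub_smul] at e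
  rcases smul_eq_zero.mp e with h5 | h5
  · rw [sub_eq_zero] at h5
    have := Nat.cast_injective h5
    omega
  · exact h5

theorem lk_mul {i j : ℕ} {x y : ExteriorAlgebra ℝ F} (hx : x ∈ ⋀[ℝ]^i F) (hy : y ∈ ⋀[ℝ]^j F) :
    x * y ∈ ⋀[ℝ]^(i + j) F := by
  unfold exteriorPower at *
  rw [pow_add]
  exact Submodule.mul_mem_mul hx hy

theorem lk_iota (v : F) : ι ℝ v ∈ ⋀[ℝ]^1 F := by
  unfold exteriorPower
  rw [pow_one]
  exact ⟨v, rfl⟩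

theorem lk_nondeg [FiniteDimensional ℝ F] (j : ℕ) : ∀ (m : ℕ), j + m = Module.finrank ℝ F →
    ∀ x ∈ ⋀[ℝ]^m F, (∀ y ∈ ⋀[ℝ]^j F, y * x = 0) → x = 0 := by
  induction j with
  | zero =>
    intro m _ x _ h
    simpa using h 1 (by simp)
  | succ j ih =>
    intro m hm x hx h
    refine lk_zero (by omega) hx fun v => ?_
    refine ih (1 + m) (by omega) _ (lk_mul (lk_iota v) hx) fun y hy => ?_
    rw [← mul_assoc]
    exact h _ (lk_mul hy (lk_iota v))

theorem lk_big [FiniteDimensional ℝ F] {m : ℕ} (hm : Module.finrank ℝ F < m)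
    {x : ExteriorAlgebra ℝ F} (hx : x ∈ ⋀[ℝ]^m F) : x = 0 := by
  have h : Module.finrank ℝ (⋀[ℝ]^m F) = 0 := by
    rw [exteriorPower.finrank_eq, Nat.choose_eq_zero_of_lt hm]
  have := (Submodule.finrank_eq_zero.mp h)
  rw [this] at hx
  simpa using hx

theorem lk_dual [FiniteDimensional ℝ F] {k m : ℕ} (hkm : k + m = Module.finrank ℝ F)
    (f : ExteriorAlgebra ℝ F →ₗ[ℝ] ℝ) :
    ∃ γ ∈ ⋀[ℝ]^m F, ∀ x ∈ ⋀[ℝ]^k F, (x * γ = 0 ↔ f x = 0) := by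
  have h1 : Module.finrank ℝ (⋀[ℝ]^(k + m) F) = 1 := by
    rw [exteriorPower.finrank_eq, hkm, Nat.choose_self]
  let e : (⋀[ℝ]^(k + m) F) ≃ₗ[ℝ] ℝ :=
    LinearEquiv.ofFinrankEq _ _ (by rw [h1, Module.finrank_self])
  let Φ : (⋀[ℝ]^m F) →ₗ[ℝ] Module.Dual ℝ (⋀[ℝ]^k F) :=
    LinearMap.mk₂ ℝ (fun y x => e ⟨x.1 * y.1, lk_mul x.2 y.2⟩)
      (by intro a b c; rw [← map_add]; congr 1; ext; simp [mul_add])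
      (by intro a b c; rw [← map_smul]; congr 1; ext; simp)
      (by intro a b c; rw [← map_add]; congr 1; ext; simp [add_mul])
      (by intro a b c; rw [← map_smul]; congr 1; ext; simp)
  have hΦ : ∀ y x, Φ y x = e ⟨x.1 * y.1, lk_mul x.2 y.2⟩ := fun _ _ => rfl
  have hinj : Function.Injective Φ := by
    rw [injective_iff_map_eq_zero]
    intro y hy
    ext
    refine lk_nondeg k m hkm _ y.2 fun x hx => ?_
    have := hΦ y ⟨x, hx⟩
    rw [hy, LinearMap.zero_apply, eq_comm, LinearEquiv.map_eq_zero_iff] at this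
    simpa using congrArg Subtype.val this
  have hd : Module.finrank ℝ (⋀[ℝ]^m F) = Module.finrank ℝ (Module.Dual ℝ (⋀[ℝ]^k F)) := by
    rw [Subspace.dual_finrank_eq, exteriorPower.finrank_eq, exteriorPower.finrank_eq, ← hkm]
    exact (Nat.choose_symm_add).symm
  obtain ⟨γ, hγ⟩ := (LinearMap.injective_iff_surjective_of_finrank_eq_finrank hd).mp hinj
    (f ∘ₗ (⋀[ℝ]^k F).subtype)
  refine ⟨γ.1, γ.2, fun x hx => ?_⟩
  have := hΦ γ ⟨x, hx⟩
  rw [hγ] at this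
  simp only [LinearMap.comp_apply, Submodule.subtype_apply] at this
  rw [this, LinearEquiv.map_eq_zero_iff, Subtype.ext_iff]
  simp

theorem lk_powE_le (E : Submodule ℝ F) (j : ℕ) : powE E (j : ℤ) ≤ ⋀[ℝ]^j F := by
  unfold powE
  simp only [Nat.cast_nonneg, if_true, Int.toNat_natCast]
  refine pow_le_pow_left₀ (zero_le) ?_ j
  rintro _ ⟨v, _, rfl⟩
  exact ⟨v, rfl⟩

theorem lk_powE_mul (E : Submodule ℝ F) {i j : ℤ} {x y : ExteriorAlgebra ℝ F}
    (hx : x ∈ powE E i) (hy : y ∈ powE E j) : x * y ∈ powE E (i + j) := by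
  unfold powE at *
  split_ifs at hx with hi
  · split_ifs at hy with hj
    · rw [if_pos (by omega), Int.toNat_add hi hj, pow_add]
      exact Submodule.mul_mem_mul hx hy
    · rw [Submodule.mem_bot] at hy
      simp [hy]
  · rw [Submodule.mem_bot] at hx
    simp [hx]

theorem lk_powE_iota (E : Submodule ℝ F) {v : F} (hv : v ∈ E) : ι ℝ v ∈ powE E 1 := by
  unfold powE
  simp only [zero_le_one, if_true, Int.toNat_one, pow_one]
  exact ⟨v, hv, rfl⟩

theorem lk_decomp (E : Submodule ℝ F) (θ : F)
    (hE : ∀ v : F, ∃ e ∈ E, ∃ c : ℝ, v = e + c • θ)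
    {j : ℕ} {x : ExteriorAlgebra ℝ F} (hx : x ∈ ⋀[ℝ]^j F) :
    ∃ a ∈ powE E (j : ℤ), ∃ b ∈ powE E ((j : ℤ) - 1), x = a + ι ℝ θ * b := by
  refine lk_ind j (fun j x => ∃ a ∈ powE E (j : ℤ), ∃ b ∈ powE E ((j : ℤ) - 1),
    x = a + ι ℝ θ * b) ?_ ?_ ?_ x hx
  · intro r
    refine ⟨_, ?_, 0, zero_mem _, by rw [mul_zero, add_zero]⟩
    simp [powE]
  · rintro i x y ⟨a, ha, b, hb, rfl⟩ ⟨c, hc, d, hd, rfl⟩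
    exact ⟨_, add_mem ha hc, _, add_mem hb hd, by rw [mul_add]; abel⟩
  · rintro i v x - ⟨a, ha, b, hb, rfl⟩
    obtain ⟨e, he, c, rfl⟩ := hE v
    have h2 : ι ℝ e * ι ℝ θ = - (ι ℝ θ * ι ℝ e) :=
        eq_neg_of_add_eq_zero_left (ι_add_mul_swap _ _)
    refine ⟨ι ℝ e * a, ?_, c • a - ι ℝ e * b, sub_mem (Submodule.smul_mem _ _ ?_) ?_, ?_⟩
    · have := lk_powE_mul E (lk_powE_iota E he) ha
      rwa [add_comm] at this
    · simpa using ha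
    · have := lk_powE_mul E (lk_powE_iota E he) hb
      convert this using 1
      congr 1
      push_cast
      ring
    · have h3 : ι ℝ θ * (ι ℝ θ * b) = 0 := by rw [← mul_assoc, ι_sq_zero, zero_mul]
      have h4 : ι ℝ e * (ι ℝ θ * b) = - (ι ℝ θ * (ι ℝ e * b)) := by
        rw [← mul_assoc, h2, neg_mul, mul_assoc]
      simp only [map_add, map_smul, add_mul, mul_add, h4, smul_mul_assoc, h3, mul_sub,
        mul_smul_comm, smul_zero]
      abel

theorem lk_comm2 {ω : ExteriorAlgebra ℝ F} (hω : ω ∈ ⋀[ℝ]^2 F) {j : ℕ}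
    {x : ExteriorAlgebra ℝ F} (hx : x ∈ ⋀[ℝ]^j F) : ω * x = x * ω := by
  refine lk_ind j (fun _ x => ω * x = x * ω) ?_ ?_ ?_ x hx
  · intro r
    exact (Algebra.commutes r ω).symm
  · intro i x y h1 h2
    rw [mul_add, add_mul, h1, h2]
  · intro i v x _ h
    have := lk_comm v hω
    simp only [even_two, Even.neg_pow, one_pow, one_smul] at this
    rw [← mul_assoc, ← this, mul_assoc, h, mul_assoc]

end LK

theorem left_kernel_eq_I {F : Type*} [AddCommGroup F] [Module ℝ F]
    [FiniteDimensional ℝ F]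
    (n : ℕ) (hn : 1 ≤ n) (hdimF : Module.finrank ℝ F = 2 * n + 1)
    (E : Submodule ℝ F) (hdimE : Module.finrank ℝ E = 2 * n)
    (θ : F) (hθ : θ ∉ E)
    (ω : ExteriorAlgebra ℝ F) (hω : ω ∈ powE E 2) (hωn : ω ^ n ≠ 0)
    (k : ℕ) (hk : k ≤ n) (α : ExteriorAlgebra ℝ F) (hα : α ∈ ⋀[ℝ]^k F) :
    (∀ γ ∈ ⋀[ℝ]^(2 * n + 1 - k) F, γ * ι ℝ θ = 0 → γ * ω = 0 → α * γ = 0) ↔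
      memI E θ ω (k : ℤ) α := by
  have hω2 : ω ∈ ⋀[ℝ]^2 F := lk_powE_le E 2 hω
  have hE : ∀ v : F, ∃ e ∈ E, ∃ c : ℝ, v = e + c • θ := by
    have hlt : E < E ⊔ Submodule.span ℝ {θ} := by
      refine lt_of_le_of_ne le_sup_left fun h => hθ ?_
      rw [h]
      exact Submodule.mem_sup_right (Submodule.mem_span_singleton_self θ)
    have h1 := Submodule.finrank_lt_finrank_of_lt hlt
    have htop : E ⊔ Submodule.span ℝ {θ} = ⊤ := by
      apply Submodule.eq_top_of_finrank_eq
      have := Submodule.finrank_le (E ⊔ Submodule.span ℝ {θ})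
      omega
    intro v
    have hv : v ∈ E ⊔ Submodule.span ℝ {θ} := by rw [htop]; trivial
    obtain ⟨e, he, t, ht, rfl⟩ := Submodule.mem_sup.mp hv
    obtain ⟨c, rfl⟩ := Submodule.mem_span_singleton.mp ht
    exact ⟨e, he, c, rfl⟩
  have hgr : ∀ (j : ℤ) (a : ExteriorAlgebra ℝ F), a ∈ powE E j → ∃ i : ℕ, a ∈ ⋀[ℝ]^i F := by
    intro j a ha
    by_cases hj : 0 ≤ j
    · lift j to ℕ using hj
      exact ⟨j, lk_powE_le E j ha⟩
    · rw [powE, if_neg hj, Submodule.mem_bot] at ha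
      exact ⟨0, ha ▸ zero_mem _⟩
  constructor
  · intro H
    let I : Submodule ℝ (ExteriorAlgebra ℝ F) :=
      (powE E ((k : ℤ) - 1)).map (LinearMap.mulLeft ℝ (ι ℝ θ)) ⊔
      (powE E ((k : ℤ) - 2)).map (LinearMap.mulLeft ℝ ω)
    have hI : ∀ x, x ∈ I ↔ memI E θ ω (k : ℤ) x := by
      intro x
      simp only [I, memI, Submodule.mem_sup, Submodule.mem_map, LinearMap.mulLeft_apply]
      constructor
      · rintro ⟨_, ⟨a, ha, rfl⟩, _, ⟨b, hb, rfl⟩, rfl⟩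
        exact ⟨a, ha, b, hb, rfl⟩
      · rintro ⟨a, ha, b, hb, rfl⟩
        exact ⟨_, ⟨a, ha, rfl⟩, _, ⟨b, hb, rfl⟩, rfl⟩
    rw [← hI]
    by_contra hαI
    obtain ⟨f, hfα, hfI⟩ := Submodule.exists_le_ker_of_notMem hαI
    obtain ⟨γ, hγ, hγf⟩ := lk_dual (k := k) (m := 2 * n + 1 - k) (by omega) f
    refine hfα ((hγf α hα).mp (H γ hγ ?_ ?_))
    · have hd := lk_mul hγ (lk_iota θ)
      rcases Nat.eq_zero_or_pos k with rfl | hk0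
      · exact lk_big (by omega) hd
      · refine lk_nondeg (k - 1) _ (by omega) _ hd fun x hx => ?_
        have hθx : ι ℝ θ * x ∈ I := by
          rw [hI]
          obtain ⟨a, ha, b, hb, rfl⟩ := lk_decomp E θ hE hx
          refine ⟨a, ?_, 0, zero_mem _, ?_⟩
          · rwa [Nat.cast_sub (by omega), Nat.cast_one] at ha
          · rw [mul_add, ← mul_assoc, ι_sq_zero]
            simp
        have h1 : ι ℝ θ * x ∈ ⋀[ℝ]^k F := by
          have := lk_mul (lk_iota θ) hx
          rwa [show 1 + (k - 1) = k by omega] at this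
        have h2 := (hγf _ h1).mpr (hfI hθx)
        rw [mul_assoc, lk_comm θ (lk_mul hx hγ), mul_assoc] at h2
        rcases smul_eq_zero.mp h2 with h3 | h3
        · exact absurd h3 (by simp)
        · exact h3
    · have hd := lk_mul hγ hω2
      rcases Nat.lt_or_ge k 2 with hk0 | hk0
      · exact lk_big (by omega) hd
      · refine lk_nondeg (k - 2) _ (by omega) _ hd fun x hx => ?_
        have hθx : ω * x ∈ I := by
          rw [hI]
          obtain ⟨a, ha, b, hb, rfl⟩ := lk_decomp E θ hE hx
          refine ⟨ω * b, ?_, a, ?_, ?_⟩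
          · have := lk_powE_mul E hω hb
            convert this using 1
            congr 1
            omega
          · rwa [Nat.cast_sub (by omega), Nat.cast_two] at ha
          · rw [mul_add, ← mul_assoc, lk_comm2 hω2 (lk_iota θ), mul_assoc, add_comm]
        have h1 : ω * x ∈ ⋀[ℝ]^k F := by
          have := lk_mul hω2 hx
          rwa [show 2 + (k - 2) = k by omega] at this
        have h2 := (hγf _ h1).mpr (hfI hθx)
        rwa [mul_assoc, lk_comm2 hω2 (lk_mul hx hγ), mul_assoc] at h2
  · rintro ⟨a, ha, b, hb, rfl⟩ γ hγ h1 h2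
    obtain ⟨i, hai⟩ := hgr _ _ ha
    obtain ⟨j, hbj⟩ := hgr _ _ hb
    rw [add_mul, mul_assoc, lk_comm θ (lk_mul hai hγ), mul_assoc, h1, mul_assoc,
      lk_comm2 hω2 (lk_mul hbj hγ), mul_assoc, h2]
    simp
end

section
/- For every integer k with 0 ≤ k ≤ n and every γ ∈ J^{2n+1−k}, if α ∧ γ = 0 for every α ∈ ⋀^k F, then γ = 0. In other words, the wedge-product pairing (⋀^k F / I^k) × J^{2n+1−k} → ⋀^{2n+1}F has trivial right kernel; combined with the triviality of the left kernel, this pairing is nondegenerate (Lemma 3.2(2) of the paper). -/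
open ExteriorAlgebra

/-- for `0 ≤ k ≤ n` and `γ ∈ J^{2n+1-k}` (i.e. `γ ∈ ⋀^{2n+1-k} F` with
`γ ∧ θ = 0` and `γ ∧ ω = 0`), if `α ∧ γ = 0` for every `α ∈ ⋀^k F`, then `γ = 0`;
i.e. the pairing `(⋀^k F / I^k) × J^{2n+1-k} → ⋀^{2n+1} F` has trivial right kernel. -/
theorem right_kernel_trivial {F : Type*} [AddCommGroup F] [Module ℝ F]
    [FiniteDimensional ℝ F]
    (n : ℕ) (hn : 1 ≤ n) (hdimF : Module.finrank ℝ F = 2 * n + 1)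
    (E : Submodule ℝ F) (hdimE : Module.finrank ℝ E = 2 * n)
    (θ : F) (hθ : θ ∉ E)
    (ω : ExteriorAlgebra ℝ F) (hω : ω ∈ powE E 2) (hωn : ω ^ n ≠ 0)
    (k : ℕ) (hk : k ≤ n) (γ : ExteriorAlgebra ℝ F)
    (hγ : γ ∈ ⋀[ℝ]^(2 * n + 1 - k) F) (hγθ : γ * ι ℝ θ = 0) (hγω : γ * ω = 0)
    (h : ∀ α ∈ ⋀[ℝ]^k F, α * γ = 0) :
    γ = 0 := by
  classical
  let b : Module.Basis (Fin (2 * n + 1)) ℝ F := Module.finBasisOfFinrankEq ℝ F hdimF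
  suffices hz : (⟨γ, hγ⟩ : ⋀[ℝ]^(2 * n + 1 - k) F) = 0 from congrArg Subtype.val hz
  have hsum := (b.exteriorPower (2 * n + 1 - k)).sum_repr ⟨γ, hγ⟩
  have hsum' : γ = ∑ s, ((b.exteriorPower (2 * n + 1 - k)).repr ⟨γ, hγ⟩ s) •
      b.ExteriorAlgebra (s : Finset (Fin (2 * n + 1))) := by
    have h1 := congrArg Subtype.val hsum
    simp only [Submodule.coe_sum, Submodule.coe_smul] at h1
    simp only [basis_eq_coe_basis]
    exact h1.symm
  apply (b.exteriorPower (2 * n + 1 - k)).ext_elem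
  intro s
  have hcard : ((s : Finset (Fin (2 * n + 1)))ᶜ).card = k := by
    rw [Finset.card_compl, Set.powersetCard.card_eq s, Fintype.card_fin]
    omega
  let t : Set.powersetCard (Fin (2 * n + 1)) k := Set.powersetCard.ofCard hcard
  have ht : t.val = (s : Finset (Fin (2 * n + 1)))ᶜ := rfl
  have hdis : Disjoint t.val s.val := by
    rw [ht]
    exact disjoint_compl_left
  have h2 : b.ExteriorAlgebra (t : Finset (Fin (2 * n + 1))) * γ = 0 := by
    apply h
    rw [basis_eq_coe_basis]
    exact Subtype.property _
  rw [hsum', Finset.mul_sum, Finset.sum_eq_single s] at h2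
  · rw [mul_smul_comm, basis_mul_of_disjoint b t s hdis] at h2
    rcases smul_eq_zero.mp h2 with h3 | h3
    · simpa using h3
    · exfalso
      rw [smul_eq_zero_iff_eq] at h3
      exact b.ExteriorAlgebra.ne_zero _ h3
  · intro u _ hu
    rw [mul_smul_comm, basis_mul_of_not_disjoint, smul_zero]
    intro hd
    apply hu
    rw [Set.powersetCard.eq_iff_subset]
    intro x hx
    by_contra hxs
    exact Finset.disjoint_left.mp hd (by rw [ht]; exact Finset.mem_compl.mpr hxs) hx
  · simp
end
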